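/- Let F be a field, N a positive integer and 0 ≤ r ≤ N. For a ∈ GL_N(F), the conjugate ε_r·â·ε_r^{−1} belongs to Q_N(F) if and only if a ∈ P_{r,N−r}(F). Equivalently, the intersection of the Levi subgroup M_N(F) = { â : a ∈ GL_N(F) } with ε_r^{−1}·Q_N(F)·ε_r equals { â : a ∈ P_{r,N−r}(F) }. -/

import Mathlib

open Matrix

/-- The `k × k` permutation matrix with `1`'s along the main anti-diagonal. -/
def wM (F : Type*) [Field F] (k : ℕ) : Matrix (Fin k) (Fin k) F :=
  Matrix.of fun i j => if (i : ℕ) + (j : ℕ) + 1 = k then 1 else 0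

/-- The `2k × 2k` matrix `J_k = ((0, w_k), (−w_k, 0))` defining the symplectic form. -/
def JM (F : Type*) [Field F] (k : ℕ) :
    Matrix (Fin k ⊕ Fin k) (Fin k ⊕ Fin k) F :=
  Matrix.fromBlocks 0 (wM F k) (-(wM F k)) 0

/-- The symplectic group `Sp_{2k}(F) = { g ∈ GL_{2k}(F) : ᵗg·J_k·g = J_k }`,
as a set of `2k × 2k` matrices (indexed by `Fin k ⊕ Fin k`). -/
def Sp (F : Type*) [Field F] (k : ℕ) :
    Set (Matrix (Fin k ⊕ Fin k) (Fin k ⊕ Fin k) F) :=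
  { g | IsUnit g ∧ gᵀ * JM F k * g = JM F k }

/-- The global (natural-number) index of a row/column index of a `2k × 2k` matrix. -/
def idx {k : ℕ} : Fin k ⊕ Fin k → ℕ
  | Sum.inl i => (i : ℕ)
  | Sum.inr i => k + (i : ℕ)

/-- The Weyl representative `ε_r = diag(I_r, ((0, I_{N−r}), (−I_{N−r}, 0)), I_r)`,
written entrywise in global coordinates. -/
def eps (F : Type*) [Field F] (N r : ℕ) :
    Matrix (Fin N ⊕ Fin N) (Fin N ⊕ Fin N) F :=
  Matrix.of fun p q =>
    if idx p = idx q ∧ (idx q < r ∨ 2 * N - r ≤ idx q) then 1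
    else if r ≤ idx p ∧ idx p < N ∧ idx q = idx p + (N - r) then 1
    else if N ≤ idx p ∧ idx p < 2 * N - r ∧ idx p = idx q + (N - r) then -1
    else 0

/-- The Siegel parabolic subgroup `Q_N(F)`. -/
def QN (F : Type*) [Field F] (N : ℕ) :
    Set (Matrix (Fin N ⊕ Fin N) (Fin N ⊕ Fin N) F) :=
  { g | g ∈ Sp F N ∧ Matrix.toBlocks₂₁ g = 0 }

/-- `a* = w_N·ᵗa⁻¹·w_N` for `a ∈ GL_N(F)`. -/
def aSt (F : Type*) [Field F] (N : ℕ) (a : GL (Fin N) F) :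
    Matrix (Fin N) (Fin N) F :=
  wM F N * (↑(a⁻¹) : Matrix (Fin N) (Fin N) F)ᵀ * wM F N

/-- `â = diag(a, a*)` for `a ∈ GL_N(F)`. -/
def hatN (F : Type*) [Field F] (N : ℕ) (a : GL (Fin N) F) :
    Matrix (Fin N ⊕ Fin N) (Fin N ⊕ Fin N) F :=
  Matrix.fromBlocks (↑a : Matrix (Fin N) (Fin N) F) 0 0 (aSt F N a)

/-- Membership of `a ∈ GL_N(F)` in the standard parabolic `P_{r,N−r}(F)`:
block upper-triangular with diagonal blocks of sizes `r` and `N−r`. -/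
def Pblock (F : Type*) [Field F] (N r : ℕ) (a : GL (Fin N) F) : Prop :=
  ∀ i j : Fin N, r ≤ (i : ℕ) → (j : ℕ) < r → (↑a : Matrix (Fin N) (Fin N) F) i j = 0

theorem wM_eq (F : Type*) [Field F] (k : ℕ) (i j : Fin k) :
    wM F k i j = if j = i.rev then 1 else 0 := by
  simp only [wM, Matrix.of_apply, Fin.ext_iff, Fin.val_rev]
  congr 1
  apply propext
  omega

theorem wM_transpose (F : Type*) [Field F] (k : ℕ) : (wM F k)ᵀ = wM F k := by
  ext i j
  simp only [Matrix.transpose_apply, wM, Matrix.of_apply]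
  congr 2
  omega

theorem wM_mul_apply (F : Type*) [Field F] (k : ℕ) (M : Matrix (Fin k) (Fin k) F) (i j : Fin k) :
    (wM F k * M) i j = M i.rev j := by
  simp [Matrix.mul_apply, wM_eq]

theorem mul_wM_apply (F : Type*) [Field F] (k : ℕ) (M : Matrix (Fin k) (Fin k) F) (i j : Fin k) :
    (M * wM F k) i j = M i j.rev := by
  rw [← Matrix.transpose_apply (M * wM F k), Matrix.transpose_mul, wM_transpose, wM_mul_apply,
    Matrix.transpose_apply]

theorem wM_mul_self (F : Type*) [Field F] (k : ℕ) : wM F k * wM F k = 1 := by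
  ext i j
  rw [wM_mul_apply, wM_eq, Fin.rev_rev, Matrix.one_apply]
  simp only [eq_comm]

theorem JM_mul_self (F : Type*) [Field F] (k : ℕ) : JM F k * JM F k = -1 := by
  simp [JM, Matrix.fromBlocks_multiply, wM_mul_self, ← Matrix.fromBlocks_one,
    Matrix.fromBlocks_neg]

theorem mem_Sp_of_transpose_mul {F : Type*} [Field F] {k : ℕ}
    {g : Matrix (Fin k ⊕ Fin k) (Fin k ⊕ Fin k) F} (h : gᵀ * JM F k * g = JM F k) :
    g ∈ Sp F k := by
  refine ⟨IsUnit.of_mul_eq_one_right (-(JM F k * gᵀ * JM F k)) ?_, h⟩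
  rw [neg_mul, Matrix.mul_assoc (JM F k), Matrix.mul_assoc (JM F k), h, JM_mul_self, neg_neg]

theorem aSt_apply (F : Type*) [Field F] (N : ℕ) (a : GL (Fin N) F) (i j : Fin N) :
    aSt F N a i j = (↑(a⁻¹) : Matrix (Fin N) (Fin N) F) j.rev i.rev := by
  rw [aSt, mul_wM_apply, wM_mul_apply, Matrix.transpose_apply]

theorem hatN_mem_Sp (F : Type*) [Field F] (N : ℕ) (a : GL (Fin N) F) : hatN F N a ∈ Sp F N := by
  apply mem_Sp_of_transpose_mul
  have hw : ∀ M : Matrix (Fin N) (Fin N) F, wM F N * (wM F N * M) = M := fun M => by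
    rw [← Matrix.mul_assoc, wM_mul_self, Matrix.one_mul]
  have h₁ : (↑a : Matrix (Fin N) (Fin N) F)ᵀ * wM F N * aSt F N a = wM F N := by
    rw [aSt, Matrix.mul_assoc, Matrix.mul_assoc, hw, ← Matrix.mul_assoc, ← Matrix.transpose_mul,
      Units.inv_mul, Matrix.transpose_one, Matrix.one_mul]
  have h₂ : (aSt F N a)ᵀ * wM F N * (↑a : Matrix (Fin N) (Fin N) F) = wM F N := by
    simp only [aSt, Matrix.transpose_mul, wM_transpose, Matrix.transpose_transpose,
      Matrix.mul_assoc]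
    rw [hw, Units.inv_mul, Matrix.mul_one]
  simp [hatN, JM, Matrix.fromBlocks_transpose, Matrix.fromBlocks_multiply, h₁, h₂]

/-- The permutation underlying `eps F N r`: row `p` is supported in column `epsPerm r p`. -/
def epsPerm {N : ℕ} (r : ℕ) : Fin N ⊕ Fin N → Fin N ⊕ Fin N
  | Sum.inl i => if (i : ℕ) < r then Sum.inl i else Sum.inr ⟨i - r, by omega⟩
  | Sum.inr i => if h : (i : ℕ) + r < N then Sum.inl ⟨i + r, h⟩ else Sum.inr i

/-- The nonzero entry of row `p` of `eps F N r`. -/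
def epsSign (F : Type*) [Field F] {N : ℕ} (r : ℕ) : Fin N ⊕ Fin N → F
  | Sum.inl _ => 1
  | Sum.inr i => if (i : ℕ) + r < N then -1 else 1

theorem idx_injective {k : ℕ} : Function.Injective (idx : Fin k ⊕ Fin k → ℕ) := by
  rintro (i | i) (j | j) h <;> simp only [idx] at h
  · exact congrArg Sum.inl (Fin.ext h)
  · omega
  · omega
  · exact congrArg Sum.inr (Fin.ext (by omega))

theorem idx_epsPerm {N r : ℕ} (hr : r ≤ N) (p : Fin N ⊕ Fin N) :
    idx (epsPerm r p) = if idx p < r ∨ 2 * N - r ≤ idx p then idx p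
      else if idx p < N then idx p + (N - r) else idx p - (N - r) := by
  rcases p with i | i <;> simp only [epsPerm] <;> split_ifs <;> simp only [idx] at * <;> omega

theorem epsPerm_injective {N r : ℕ} (hr : r ≤ N) :
    Function.Injective (epsPerm r : Fin N ⊕ Fin N → Fin N ⊕ Fin N) := by
  intro p q h
  apply idx_injective
  have h' := congrArg idx h
  rw [idx_epsPerm hr, idx_epsPerm hr] at h'
  split_ifs at h' <;> omega

theorem eps_apply_of_idx_eq (F : Type*) [Field F] {N r x y : ℕ} {p q : Fin N ⊕ Fin N}
    (hp : idx p = x) (hq : idx q = y) :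
    eps F N r p q =
      if x = y ∧ (y < r ∨ 2 * N - r ≤ y) then 1
      else if r ≤ x ∧ x < N ∧ y = x + (N - r) then 1
      else if N ≤ x ∧ x < 2 * N - r ∧ x = y + (N - r) then -1
      else 0 := by
  subst hp hq
  rfl

theorem eps_apply (F : Type*) [Field F] {N r : ℕ} (hr : r ≤ N) (p q : Fin N ⊕ Fin N) :
    eps F N r p q = if q = epsPerm r p then epsSign F r p else 0 := by
  have hσ := idx_epsPerm hr p
  have hq : q = epsPerm r p ↔ idx q = idx (epsPerm r p) := idx_injective.eq_iff.symm
  have hs : ∀ x, idx p = x → epsSign F r p = if N ≤ x ∧ x < 2 * N - r then -1 else 1 := by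
    intro x hx
    rcases p with i | i <;> simp only [epsSign, idx] at hx ⊢ <;> split_ifs <;> first | rfl | omega
  have hN : idx p < 2 * N := by rcases p with i | i <;> simp only [idx] <;> omega
  rw [eps_apply_of_idx_eq F rfl rfl, hs _ rfl]
  simp only [hq]
  generalize idx (epsPerm r p) = z at hσ
  clear hq hs
  generalize idx p = x at *
  generalize idx q = y
  split_ifs at hσ <;> split_ifs <;> first | rfl | omega

theorem eps_conj_apply (F : Type*) [Field F] {N r : ℕ} (hr : r ≤ N)
    (M : Matrix (Fin N ⊕ Fin N) (Fin N ⊕ Fin N) F) (p q : Fin N ⊕ Fin N) :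
    (eps F N r * M * (eps F N r)ᵀ) p q =
      epsSign F r p * M (epsPerm r p) (epsPerm r q) * epsSign F r q := by
  simp [Matrix.mul_apply, eps_apply F hr]

theorem epsSign_mul_self (F : Type*) [Field F] {N : ℕ} (r : ℕ) (p : Fin N ⊕ Fin N) :
    epsSign F r p * epsSign F r p = 1 := by
  rcases p with i | i <;> simp only [epsSign]
  · exact mul_one 1
  · split_ifs <;> simp

theorem epsSign_ne_zero (F : Type*) [Field F] {N : ℕ} (r : ℕ) (p : Fin N ⊕ Fin N) :
    epsSign F r p ≠ 0 :=
  left_ne_zero_of_mul_eq_one (epsSign_mul_self F r p)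

theorem eps_mul_transpose (F : Type*) [Field F] {N r : ℕ} (hr : r ≤ N) :
    eps F N r * (eps F N r)ᵀ = 1 := by
  ext p q
  have h := eps_conj_apply F hr 1 p q
  rw [Matrix.mul_one] at h
  rw [h, Matrix.one_apply, Matrix.one_apply]
  by_cases hpq : p = q
  · simp only [hpq, if_true, mul_one, epsSign_mul_self]
  · simp only [(epsPerm_injective hr).eq_iff, hpq, if_false, mul_zero, zero_mul]

theorem eps_inv (F : Type*) [Field F] {N r : ℕ} (hr : r ≤ N) :
    (eps F N r)⁻¹ = (eps F N r)ᵀ :=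
  Matrix.inv_eq_right_inv (eps_mul_transpose F hr)

theorem transpose_mul_eps (F : Type*) [Field F] {N r : ℕ} (hr : r ≤ N) :
    (eps F N r)ᵀ * eps F N r = 1 :=
  mul_eq_one_comm.mp (eps_mul_transpose F hr)

theorem eps_conj_JM (F : Type*) [Field F] {N r : ℕ} (hr : r ≤ N) :
    eps F N r * JM F N * (eps F N r)ᵀ = JM F N := by
  ext p q
  rw [eps_conj_apply F hr]
  rcases p with i | i <;> rcases q with j | j <;> simp only [epsPerm, epsSign] <;> split_ifs <;>
    simp [JM, wM] <;> first | omega | (split_ifs <;> first | rfl | exact neg_zero.symm | omega)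

theorem eps_conj_mem_Sp {F : Type*} [Field F] {N r : ℕ} (hr : r ≤ N)
    {g : Matrix (Fin N ⊕ Fin N) (Fin N ⊕ Fin N) F} (hg : g ∈ Sp F N) :
    eps F N r * g * (eps F N r)ᵀ ∈ Sp F N := by
  apply mem_Sp_of_transpose_mul
  set E := eps F N r
  have hE : Eᵀ * JM F N * E = JM F N := by
    calc Eᵀ * JM F N * E = Eᵀ * (E * JM F N * Eᵀ) * E := by rw [eps_conj_JM F hr]
      _ = (Eᵀ * E) * JM F N * (Eᵀ * E) := by simp only [Matrix.mul_assoc]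
      _ = JM F N := by rw [transpose_mul_eps F hr, Matrix.one_mul, Matrix.mul_one]
  calc (E * g * Eᵀ)ᵀ * JM F N * (E * g * Eᵀ)
      = E * (gᵀ * (Eᵀ * JM F N * E) * g) * Eᵀ := by
        simp only [Matrix.transpose_mul, Matrix.transpose_transpose, Matrix.mul_assoc]
    _ = JM F N := by rw [hE, hg.2, eps_conj_JM F hr]

theorem Pblock.inv {F : Type*} [Field F] {N r : ℕ} {a : GL (Fin N) F} (h : Pblock F N r a) :
    Pblock F N r a⁻¹ := by
  have : Invertible (↑a : Matrix (Fin N) (Fin N) F) := a.invertible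
  have hb : Matrix.BlockTriangular (↑a : Matrix (Fin N) (Fin N) F)
      (fun i : Fin N => if r ≤ (i : ℕ) then 1 else 0) := by
    intro i j hij
    dsimp only at hij
    split_ifs at hij <;> first | omega | exact h i j ‹_› (by omega)
  intro i j hi hj
  rw [Matrix.coe_units_inv]
  apply Matrix.blockTriangular_inv_of_blockTriangular hb
  simp [hi, hj]

theorem eps_conj_hatN_mem_QN_iff (F : Type*) [Field F] {N r : ℕ} (hr : r ≤ N) (a : GL (Fin N) F) :
    eps F N r * hatN F N a * (eps F N r)⁻¹ ∈ QN F N ↔ Pblock F N r a := by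
  have hmem : ∀ i j, Matrix.toBlocks₂₁ (eps F N r * hatN F N a * (eps F N r)ᵀ) i j = 0 ↔
      hatN F N a (epsPerm r (Sum.inr i)) (epsPerm r (Sum.inl j)) = 0 := fun i j => by
    rw [Matrix.toBlocks₂₁, Matrix.of_apply, eps_conj_apply F hr]
    simp [epsSign_ne_zero]
  rw [eps_inv F hr]
  constructor
  · rintro ⟨-, h⟩ i j hi hj
    have h' := (hmem ⟨i - r, by omega⟩ j).mp (by rw [h]; rfl)
    simpa [epsPerm, hi, hj, hatN] using h'
  · refine fun h => ⟨eps_conj_mem_Sp hr (hatN_mem_Sp F N a), ?_⟩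
    ext i j
    refine (hmem i j).mpr ?_
    simp only [epsPerm]
    split_ifs with h₁ h₂ h₂
    · exact h _ _ (Nat.le_add_left _ _) h₂
    · rfl
    · rfl
    · simp only [hatN, Matrix.fromBlocks_apply₂₂, aSt_apply]
      exact h.inv _ _ (by simp only [Fin.val_rev]; omega) (by simp only [Fin.val_rev]; omega)

/-- For `0 ≤ r ≤ N` and `a ∈ GL_N(F)`: `ε_r·â·ε_r⁻¹ ∈ Q_N(F)` iff
`a ∈ P_{r,N−r}(F)`; equivalently `M_N(F) ∩ ε_r⁻¹·Q_N(F)·ε_r = { â : a ∈ P_{r,N−r}(F) }`. -/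
theorem eps_conj_hat_mem_QN_iff_parabolic (F : Type*) [Field F]
    (N r : ℕ) (hN : 0 < N) (hr : r ≤ N) :
    (∀ a : GL (Fin N) F,
      eps F N r * hatN F N a * (eps F N r)⁻¹ ∈ QN F N ↔ Pblock F N r a) ∧
    ({ g | ∃ a : GL (Fin N) F, g = hatN F N a } ∩
        { g | eps F N r * g * (eps F N r)⁻¹ ∈ QN F N } =
      { g | ∃ a : GL (Fin N) F, Pblock F N r a ∧ g = hatN F N a }) := by
  refine ⟨eps_conj_hatN_mem_QN_iff F hr, ?_⟩
  ext g
  constructor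
  · rintro ⟨⟨a, rfl⟩, h⟩
    exact ⟨a, (eps_conj_hatN_mem_QN_iff F hr a).mp h, rfl⟩
  · rintro ⟨a, h, rfl⟩
    exact ⟨⟨a, rfl⟩, (eps_conj_hatN_mem_QN_iff F hr a).mpr h⟩
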